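/- arXiv:1708.06077 — 2 statements merged into one kernel-verified Lean document; each statement's English description precedes it below -/
import Mathlib

section
/- Let y = Xβ + η, where X ∈ ℝ^{n×p} has unit ℓ₂-norm columns, β ∈ ℝ^p is k-sparse with support S, and η ∈ ℝ^n. Let w = X^⊤y, β_min = min_{i∈S} |β_i|, and fix σ ≥ 0 and p ≥ 2. Suppose: (i) X satisfies the (k,b)-screening condition for β with parameter b = b(n,p); (ii) ‖X^⊤η‖_∞ ≤ 2√(σ² log p); and (iii) β_min/‖β‖₂ > 2b + 4√(σ² log p)/‖β‖₂. Then for any integer d ≥ ⌈√k / (β_min/‖β‖₂ − 2b − 4√(σ² log p)/‖β‖₂)⌉ and any set Ŝ ⊆ {1,…,p} with |Ŝ| = d such that every index in Ŝ has |w_i| at least as large as |w_j| for every j ∉ Ŝ (i.e., Ŝ indexes the d largest marginal correlations), one has S ⊆ Ŝ. -/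
/-- The marginal correlation of a column `X_i` with `y = Xβ + η` splits into a signal part,
supported on any `S` outside which `β` vanishes, and a noise part. -/
lemma marginal_correlation_eq {n p : ℕ} {X : Fin n → Fin p → ℝ} {β : Fin p → ℝ}
    {η y : Fin n → ℝ} {S : Finset (Fin p)} (hβ : ∀ j ∉ S, β j = 0)
    (hy : ∀ l, y l = (∑ j, X l j * β j) + η l) (i : Fin p) :
    ∑ l, X l i * y l = (∑ j ∈ S, (∑ l, X l i * X l j) * β j) + ∑ l, X l i * η l := by
  have hsub : ∑ j ∈ S, (∑ l, X l i * X l j) * β j = ∑ j, (∑ l, X l i * X l j) * β j :=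
    Finset.sum_subset (Finset.subset_univ S) fun j _ hj => by rw [hβ j hj, mul_zero]
  simp_rw [hsub, hy, mul_add, Finset.sum_add_distrib, Finset.mul_sum, Finset.sum_mul]
  rw [Finset.sum_comm]
  simp_rw [mul_assoc]

/-- A lower bound `m` for the entries of `β` on `S` satisfies `√|S| * m ≤ ‖β‖₂`. -/
lemma sqrt_card_mul_le_sqrt_sum_sq {ι : Type*} [Fintype ι] {β : ι → ℝ} {S : Finset ι} {m : ℝ}
    (hm0 : 0 ≤ m) (hm : ∀ i ∈ S, m ≤ |β i|) :
    √(S.card : ℝ) * m ≤ √(∑ j, β j ^ 2) := by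
  apply Real.le_sqrt_of_sq_le
  calc (√(S.card : ℝ) * m) ^ 2 = ∑ _j ∈ S, m ^ 2 := by
        rw [mul_pow, Real.sq_sqrt (Nat.cast_nonneg _), Finset.sum_const, nsmul_eq_mul]
    _ ≤ ∑ j ∈ S, β j ^ 2 := Finset.sum_le_sum fun j hj => by
        rw [← sq_abs (β j)]
        exact pow_le_pow_left₀ hm0 (hm j hj) 2
    _ ≤ ∑ j, β j ^ 2 :=
        Finset.sum_le_sum_of_subset_of_nonneg (Finset.subset_univ S) fun _ _ _ => sq_nonneg _

/-- If `f` is strictly larger on `S` than off `S`, then a set `T` with at least `|S|` elements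
that collects the largest values of `f` contains `S`. -/
lemma subset_of_card_le_of_forall_lt {ι : Type*} {S T : Finset ι} {f : ι → ℝ}
    (hcard : S.card ≤ T.card) (hf : ∀ i ∈ S, ∀ j ∉ S, f j < f i)
    (hT : ∀ i ∈ T, ∀ j ∉ T, f j ≤ f i) : S ⊆ T := by
  intro i hi
  by_contra hiT
  have hTS : T ⊆ S := fun j hj => by
    by_contra hjS
    exact absurd (hT j hj i hiT) (not_le.mpr (hf i hi j hjS))
  exact hiT (Finset.eq_of_subset_of_card_le hTS hcard ▸ hi)

/-- **Sufficient conditions for ExSIS (Theorem 1).**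
If `X` has unit-norm columns and satisfies the `(k,b)`-screening condition for the
`k`-sparse vector `β`, the correlated noise is bounded as `‖X^⊤η‖_∞ ≤ 2√(σ² log p)`,
and the minimum-to-signal ratio satisfies the stated lower bound, then any set `Shat` of
`d` indices of largest marginal correlations, with
`d ≥ ⌈√k / (β_min/‖β‖₂ − 2b − 4√(σ² log p)/‖β‖₂)⌉`, contains the true support `S`. -/
theorem exsis_sufficient_conditions
    (n p k : ℕ) (hp : 2 ≤ p)
    (X : Fin n → Fin p → ℝ) (β : Fin p → ℝ) (η : Fin n → ℝ) (y : Fin n → ℝ)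
    (σ b : ℝ) (hσ : 0 ≤ σ)
    (S : Finset (Fin p)) (hS : S = Finset.univ.filter (fun i => β i ≠ 0))
    (hk : S.card = k) (hSne : S.Nonempty)
    (hunit : ∀ j, ∑ l, X l j ^ 2 = 1)
    (hy : ∀ l, y l = (∑ j, X l j * β j) + η l)
    -- the (k, b)-screening condition
    (hb0 : 0 < b) (hb1 : b < 1 / Real.sqrt k)
    (hSC1 : ∀ i ∈ S,
      |∑ j ∈ S.erase i, (∑ l, X l i * X l j) * β j| ≤ b * Real.sqrt (∑ j, β j ^ 2))
    (hSC2 : ∀ i ∉ S,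
      |∑ j ∈ S, (∑ l, X l i * X l j) * β j| ≤ b * Real.sqrt (∑ j, β j ^ 2))
    -- bounded noise correlations
    (hnoise : ∀ i, |∑ l, X l i * η l| ≤ 2 * Real.sqrt (σ ^ 2 * Real.log p))
    -- minimum-to-signal ratio condition
    (hMSR : (S.inf' hSne fun i => |β i|) / Real.sqrt (∑ j, β j ^ 2) >
      2 * b + 4 * Real.sqrt (σ ^ 2 * Real.log p) / Real.sqrt (∑ j, β j ^ 2))
    (d : ℕ)
    (hd : ((⌈Real.sqrt k /
        ((S.inf' hSne fun i => |β i|) / Real.sqrt (∑ j, β j ^ 2) - 2 * b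
          - 4 * Real.sqrt (σ ^ 2 * Real.log p) / Real.sqrt (∑ j, β j ^ 2))⌉ : ℤ) : ℝ)
        ≤ (d : ℝ))
    (Shat : Finset (Fin p)) (hShatcard : Shat.card = d)
    (hShatsel : ∀ i ∈ Shat, ∀ j ∉ Shat, |∑ l, X l j * y l| ≤ |∑ l, X l i * y l|) :
    S ⊆ Shat := by
  have hβ : ∀ j ∉ S, β j = 0 := fun j hj => by simpa [hS] using hj
  set N := √(∑ j, β j ^ 2)
  set m := S.inf' hSne fun i => |β i|
  set s := √(σ ^ 2 * Real.log p)
  have hs : 0 ≤ s := Real.sqrt_nonneg _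
  have hm : ∀ i ∈ S, m ≤ |β i| := fun i hi => Finset.inf'_le (fun i => |β i|) hi
  have hm0 : 0 ≤ m := (Finset.le_inf'_iff hSne _).mpr fun i _ => abs_nonneg _
  have hN : 0 < N := by
    obtain ⟨i, hi⟩ := hSne
    refine Real.sqrt_pos.mpr (Finset.sum_pos' (fun j _ => sq_nonneg _) ⟨i, Finset.mem_univ i, ?_⟩)
    have hi0 : β i ≠ 0 := by simpa [hS] using hi
    positivity
  have hgap : 2 * (b * N) + 4 * s < m := by
    have h := mul_lt_mul_of_pos_right hMSR hN
    rw [add_mul, div_mul_cancel₀ _ hN.ne', div_mul_cancel₀ _ hN.ne'] at h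
    linarith
  have hcard : S.card ≤ Shat.card := by
    have hkm : √(k : ℝ) * (m / N) ≤ 1 := by
      rw [← mul_div_assoc, div_le_one hN, ← hk]
      exact sqrt_card_mul_le_sqrt_sum_sq hm0 hm
    have hden : 0 < m / N - 2 * b - 4 * s / N := by linarith
    have hden_le : √(k : ℝ) * (m / N - 2 * b - 4 * s / N) ≤ 1 := by
      refine le_trans (mul_le_mul_of_nonneg_left ?_ (Real.sqrt_nonneg _)) hkm
      have : 0 ≤ 4 * s / N := by positivity
      linarith
    have hkd : (k : ℝ) ≤ d := by
      refine le_trans ?_ ((Int.le_ceil _).trans hd)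
      rw [le_div_iff₀ hden]
      calc (k : ℝ) * (m / N - 2 * b - 4 * s / N)
          = √(k : ℝ) * (√(k : ℝ) * (m / N - 2 * b - 4 * s / N)) := by
            rw [← mul_assoc, Real.mul_self_sqrt (Nat.cast_nonneg k)]
        _ ≤ √(k : ℝ) := mul_le_of_le_one_right (Real.sqrt_nonneg _) hden_le
    rw [hk, hShatcard]
    exact_mod_cast hkd
  refine subset_of_card_le_of_forall_lt (f := fun i => |∑ l, X l i * y l|) hcard ?_ hShatsel
  intro i hi j hj
  have hself : ∑ l, X l i * X l i = 1 := by simpa only [sq] using hunit i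
  have hupper : |∑ l, X l j * y l| ≤ b * N + 2 * s := by
    rw [marginal_correlation_eq hβ hy]
    exact (abs_add_le _ _).trans (add_le_add (hSC2 j hj) (hnoise j))
  have hlower : |β i| - b * N - 2 * s ≤ |∑ l, X l i * y l| := by
    rw [marginal_correlation_eq hβ hy, ← Finset.add_sum_erase S _ hi, hself, one_mul]
    set A := ∑ j ∈ S.erase i, (∑ l, X l i * X l j) * β j
    set B := ∑ l, X l i * η l
    have hβi : |β i| ≤ |β i + A + B| + |A| + |B| := by
      calc |β i| = |β i + A + B - A - B| := by ring_nf
        _ ≤ |β i + A + B - A| + |B| := abs_sub _ _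
        _ ≤ |β i + A + B| + |A| + |B| := by gcongr; exact abs_sub _ _
    linarith [hSC1 i hi, hnoise i]
  linarith [hm i hi]
end

section
/- Let y = Xβ + η, where X ∈ ℝ^{n×p} has unit ℓ₂-norm columns, β ∈ ℝ^p is k-sparse with support S, β_min = min_{i∈S} |β_i|, and w = X^⊤y. Fix σ ≥ 0 and p ≥ 2. Suppose S ⊆ Ŝ ⊆ {1,…,p} with |Ŝ| = m ≤ p, X satisfies the (k,b)-screening condition for β with parameter b = b(n,p), ‖X^⊤η‖_∞ ≤ 2√(σ² log p), and β_min − b‖β‖₂ − 2√(σ² log p) > 0. Then the number t = |{j ∈ Ŝ : |w_j| ≥ min_{i∈S} |w_i|}| satisfies t ≤ (m·b‖β‖₂ + ‖β‖₁ + 2m√(σ² log p)) / (β_min − b‖β‖₂ − 2√(σ² log p)). -/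
/-- The marginal correlations of a linear model are the Gram matrix applied to the coefficients,
plus the noise correlations. -/
lemma sum_mul_linear_model {ι κ : Type*} [Fintype ι] [Fintype κ]
    (X : ι → κ → ℝ) (β : κ → ℝ) (η y : ι → ℝ)
    (hy : ∀ l, y l = (∑ j, X l j * β j) + η l) (i : κ) :
    ∑ l, X l i * y l = ∑ j, (∑ l, X l i * X l j) * β j + ∑ l, X l i * η l := by
  simp_rw [hy, mul_add, Finset.sum_add_distrib, Finset.mul_sum, Finset.sum_mul]
  rw [Finset.sum_comm]
  simp_rw [mul_assoc]

/-- For unit-norm columns, if the interference of the columns in the support is at most `B` and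
the noise correlations are at most `N`, then each marginal correlation is within `B + N` of the
corresponding coefficient. -/
lemma abs_marginal_sub_coeff_le {ι κ : Type*} [Fintype ι] [Fintype κ] [DecidableEq κ]
    (X : ι → κ → ℝ) (β : κ → ℝ) (η y : ι → ℝ) (S : Finset κ) {B N : ℝ}
    (hS : ∀ i ∉ S, β i = 0)
    (hunit : ∀ j, ∑ l, X l j ^ 2 = 1)
    (hy : ∀ l, y l = (∑ j, X l j * β j) + η l)
    (hin : ∀ i ∈ S, |∑ j ∈ S.erase i, (∑ l, X l i * X l j) * β j| ≤ B)
    (hout : ∀ i ∉ S, |∑ j ∈ S, (∑ l, X l i * X l j) * β j| ≤ B)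
    (hnoise : ∀ i, |∑ l, X l i * η l| ≤ N) (i : κ) :
    |∑ l, X l i * y l - β i| ≤ B + N := by
  have hsupp : ∑ j, (∑ l, X l i * X l j) * β j = ∑ j ∈ S, (∑ l, X l i * X l j) * β j :=
    (Finset.sum_subset (Finset.subset_univ S) fun j _ hj => by rw [hS j hj, mul_zero]).symm
  rw [sum_mul_linear_model X β η y hy, hsupp, add_sub_right_comm]
  refine (abs_add_le _ _).trans (add_le_add ?_ (hnoise i))
  by_cases hi : i ∈ S
  · have hdiag : ∑ l, X l i * X l i = 1 := by simpa only [sq] using hunit i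
    rw [← Finset.sum_erase_add _ _ hi, hdiag, one_mul, add_sub_cancel_right]
    exact hin i hi
  · rw [hS i hi, sub_zero]
    exact hout i hi

/-- If `w` is uniformly within `ε` of `β`, and `ε` is smaller than the least magnitude of `β` on
`S`, then few entries of `w` are at least as large as the least magnitude of `w` on `S`. -/
lemma card_filter_inf'_le_of_abs_sub_le {κ : Type*} [Fintype κ] (w β : κ → ℝ)
    (S T : Finset κ) (hSne : S.Nonempty) {ε : ℝ} (hw : ∀ i, |w i - β i| ≤ ε)
    (hε : 0 < (S.inf' hSne fun i => |β i|) - ε) :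
    ((T.filter fun j => |w j| ≥ S.inf' hSne fun i => |w i|).card : ℝ) ≤
      (T.card * ε + ∑ j, |β j|) / ((S.inf' hSne fun i => |β i|) - ε) := by
  rw [le_div_iff₀ hε]
  have hmin : (S.inf' hSne fun i => |β i|) - ε ≤ S.inf' hSne fun i => |w i| := by
    refine Finset.le_inf' _ _ fun i hi => ?_
    have hβ : (S.inf' hSne fun i => |β i|) ≤ |β i| := Finset.inf'_le _ hi
    have htri := abs_sub_abs_le_abs_sub (β i) (w i)
    rw [abs_sub_comm] at htri
    linarith [hw i]
  calc _ = ∑ _j ∈ T.filter fun j => |w j| ≥ S.inf' hSne fun i => |w i|,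
          ((S.inf' hSne fun i => |β i|) - ε) := by rw [Finset.sum_const, nsmul_eq_mul]
    _ ≤ ∑ j ∈ T.filter fun j => |w j| ≥ S.inf' hSne fun i => |w i|, |w j| :=
        Finset.sum_le_sum fun j hj => hmin.trans (Finset.mem_filter.mp hj).2
    _ ≤ ∑ j ∈ T, |w j| :=
        Finset.sum_le_sum_of_subset_of_nonneg (Finset.filter_subset _ _)
          fun j _ _ => abs_nonneg _
    _ ≤ ∑ j ∈ T, (ε + |β j|) :=
        Finset.sum_le_sum fun j _ => by
          linarith [hw j, abs_sub_abs_le_abs_sub (w j) (β j)]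
    _ = T.card * ε + ∑ j ∈ T, |β j| := by
        rw [Finset.sum_add_distrib, Finset.sum_const, nsmul_eq_mul]
    _ ≤ T.card * ε + ∑ j, |β j| := by
        gcongr
        exact Finset.subset_univ T

/-- **Lemma 1.** Under the `(k,b)`-screening condition and the bounded-noise event,
the number `t` of indices `j ∈ Ŝ` whose marginal correlation magnitude `|w_j|` is at
least `min_{i∈S} |w_i|` is bounded by
`(m·b‖β‖₂ + ‖β‖₁ + 2m√(σ² log p)) / (β_min − b‖β‖₂ − 2√(σ² log p))`. -/
theorem exsis_count_bound
    (n p k m : ℕ) (hp : 2 ≤ p)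
    (X : Fin n → Fin p → ℝ) (β : Fin p → ℝ) (η : Fin n → ℝ) (y : Fin n → ℝ)
    (σ b : ℝ) (hσ : 0 ≤ σ)
    (S : Finset (Fin p)) (hS : S = Finset.univ.filter (fun i => β i ≠ 0))
    (hk : S.card = k) (hSne : S.Nonempty)
    (hunit : ∀ j, ∑ l, X l j ^ 2 = 1)
    (hy : ∀ l, y l = (∑ j, X l j * β j) + η l)
    (Shat : Finset (Fin p)) (hSsub : S ⊆ Shat) (hShatcard : Shat.card = m)
    (hmp : m ≤ p)
    -- the (k, b)-screening condition
    (hb0 : 0 < b) (hb1 : b < 1 / Real.sqrt k)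
    (hSC1 : ∀ i ∈ S,
      |∑ j ∈ S.erase i, (∑ l, X l i * X l j) * β j| ≤ b * Real.sqrt (∑ j, β j ^ 2))
    (hSC2 : ∀ i ∉ S,
      |∑ j ∈ S, (∑ l, X l i * X l j) * β j| ≤ b * Real.sqrt (∑ j, β j ^ 2))
    -- bounded noise correlations
    (hnoise : ∀ i, |∑ l, X l i * η l| ≤ 2 * Real.sqrt (σ ^ 2 * Real.log p))
    -- positive denominator
    (hden : (S.inf' hSne fun i => |β i|) - b * Real.sqrt (∑ j, β j ^ 2)
      - 2 * Real.sqrt (σ ^ 2 * Real.log p) > 0) :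
    ((Shat.filter (fun j => |∑ l, X l j * y l| ≥
        S.inf' hSne fun i => |∑ l, X l i * y l|)).card : ℝ) ≤
      ((m : ℝ) * b * Real.sqrt (∑ j, β j ^ 2) + (∑ j, |β j|)
          + 2 * (m : ℝ) * Real.sqrt (σ ^ 2 * Real.log p)) /
        ((S.inf' hSne fun i => |β i|) - b * Real.sqrt (∑ j, β j ^ 2)
          - 2 * Real.sqrt (σ ^ 2 * Real.log p)) := by
  have hzero : ∀ i ∉ S, β i = 0 := by simp [hS]
  have hw := abs_marginal_sub_coeff_le X β η y S hzero hunit hy hSC1 hSC2 hnoise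
  rw [sub_sub] at hden ⊢
  refine (card_filter_inf'_le_of_abs_sub_le _ β S Shat hSne hw hden).trans_eq ?_
  rw [hShatcard]
  ring
end
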